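/- Let n ≥ k ≥ 1 be integers, let B be a k×k symmetric matrix with nonnegative entries, and let π be the standard k-equipartition of [n] that assigns the elements of [n] to k consecutive classes with sizes differing by less than 1 from n/k. Then ‖W[B_π] − W[B]‖_{L²([0,1]²)} ≤ √(10(k−1)/n) · ‖W[B]‖_{L²([0,1]²)}. -/

import Mathlib

open MeasureTheory

noncomputable section

/-- The index `i ∈ Fin m` such that `x` belongs to the `i`-th of `m` consecutive intervals
of length `1/m` partitioning `[0,1]` (clamped at the ends). -/
def blockIdx (m : ℕ) (hm : 0 < m) (x : ℝ) : Fin m :=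
  ⟨min (⌊x * m⌋).toNat (m - 1),
    Nat.lt_of_le_of_lt (Nat.min_le_right _ _) (Nat.sub_lt hm Nat.one_pos)⟩

/-- `W[M]`: the step function on `[0,1]²` equal to `M_{ij}` on `I_i × I_j`, where
`(I_1, …, I_m)` is the partition of `[0,1]` into `m` consecutive intervals of length `1/m`. -/
def stepFn (m : ℕ) (M : Matrix (Fin m) (Fin m) ℝ) : ℝ → ℝ → ℝ := fun x y =>
  if hm : 0 < m then M (blockIdx m hm x) (blockIdx m hm y) else 0

/-- The `L²` norm of a function on `[0,1]²` (with respect to Lebesgue measure). -/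
def L2norm (W : ℝ → ℝ → ℝ) : ℝ :=
  Real.sqrt (∫ p in Set.Icc (0 : ℝ) 1 ×ˢ Set.Icc (0 : ℝ) 1, (W p.1 p.2) ^ 2
    ∂(volume : Measure (ℝ × ℝ)))

/-- The standard `k`-equipartition of `[n]` into `k` consecutive classes. -/
def stdEquip (n k : ℕ) (hn : 0 < n) (hk : 0 < k) : Fin n → Fin k := fun j =>
  ⟨j.val * k / n,
    Nat.div_lt_of_lt_mul (Nat.mul_lt_mul_of_lt_of_le j.isLt le_rfl hk)⟩

/-- `B_π`: the `n×n` matrix with `(B_π)_{ij} = B_{π(i)π(j)}`. -/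
def liftPart {n k : ℕ} (π : Fin n → Fin k) (B : Matrix (Fin k) (Fin k) ℝ) :
    Matrix (Fin n) (Fin n) ℝ := fun i j => B (π i) (π j)

/-- Sum of weighted products of indicators. -/
def indSum {k : ℕ} (F : Fin k → Fin k → ℝ) (A A' : Fin k → Set ℝ) (p : ℝ × ℝ) : ℝ :=
  ∑ i, ∑ j, F i j * ((A i).indicator 1 p.1 * (A' j).indicator 1 p.2)

lemma integrable_ind (a b : ℝ) : Integrable ((Set.Icc a b).indicator (1 : ℝ → ℝ)) volume := by
  rw [integrable_indicator_iff measurableSet_Icc]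
  exact integrableOn_const (by simp)

lemma integrable_indSum {k : ℕ} (F : Fin k → Fin k → ℝ) (A A' : Fin k → Set ℝ)
    (hA : ∀ i, Integrable ((A i).indicator (1 : ℝ → ℝ)) volume)
    (hA' : ∀ i, Integrable ((A' i).indicator (1 : ℝ → ℝ)) volume) :
    Integrable (indSum F A A') volume := by
  unfold indSum
  refine integrable_finsetSum _ fun i _ => integrable_finsetSum _ fun j _ => ?_
  exact ((hA i).mul_prod (hA' j)).const_mul _

lemma integral_indSum {k : ℕ} (F : Fin k → Fin k → ℝ) (A A' : Fin k → Set ℝ)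
    (hA : ∀ i, Integrable ((A i).indicator (1 : ℝ → ℝ)) volume)
    (hA' : ∀ i, Integrable ((A' i).indicator (1 : ℝ → ℝ)) volume) (a a' : ℝ)
    (ha : ∀ i, ∫ x, (A i).indicator (1 : ℝ → ℝ) x = a)
    (ha' : ∀ i, ∫ x, (A' i).indicator (1 : ℝ → ℝ) x = a') :
    ∫ p, indSum F A A' p = (∑ i, ∑ j, F i j) * (a * a') := by
  unfold indSum
  have h : ∀ i j, Integrable (fun p : ℝ × ℝ =>
      F i j * ((A i).indicator (1 : ℝ → ℝ) p.1 * (A' j).indicator (1 : ℝ → ℝ) p.2)) volume :=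
    fun i j => ((hA i).mul_prod (hA' j)).const_mul _
  rw [integral_finsetSum _ fun i _ => integrable_finsetSum _ fun j _ => h i j, Finset.sum_mul]
  refine Finset.sum_congr rfl fun i _ => ?_
  rw [integral_finsetSum _ fun j _ => h i j, Finset.sum_mul]
  refine Finset.sum_congr rfl fun j _ => ?_
  rw [integral_const_mul, Measure.volume_eq_prod, integral_prod_mul, ha, ha']

lemma integral_ind_Icc {a b : ℝ} (h : a ≤ b) :
    ∫ x, (Set.Icc a b).indicator (1 : ℝ → ℝ) x = b - a := by
  rw [integral_indicator_one measurableSet_Icc]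
  simp [Measure.real, h]

lemma indSum_nonneg {k : ℕ} (F : Fin k → Fin k → ℝ) (hF : ∀ i j, 0 ≤ F i j)
    (A A' : Fin k → Set ℝ) (p : ℝ × ℝ) : 0 ≤ indSum F A A' p := by
  refine Finset.sum_nonneg fun i _ => Finset.sum_nonneg fun j _ => mul_nonneg (hF i j) ?_
  exact mul_nonneg (Set.indicator_nonneg (by simp) _) (Set.indicator_nonneg (by simp) _)

lemma le_indSum {k : ℕ} (F : Fin k → Fin k → ℝ) (hF : ∀ i j, 0 ≤ F i j)
    (A A' : Fin k → Set ℝ) (p : ℝ × ℝ) (i j : Fin k) (hi : p.1 ∈ A i) (hj : p.2 ∈ A' j) :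
    F i j ≤ indSum F A A' p := by
  have h0 : ∀ i j, 0 ≤ F i j * ((A i).indicator (1 : ℝ → ℝ) p.1 *
      (A' j).indicator (1 : ℝ → ℝ) p.2) := fun i j => mul_nonneg (hF i j)
    (mul_nonneg (Set.indicator_nonneg (by simp) _) (Set.indicator_nonneg (by simp) _))
  calc F i j = F i j * ((A i).indicator (1 : ℝ → ℝ) p.1 * (A' j).indicator (1 : ℝ → ℝ) p.2) := by
        simp [hi, hj]
    _ ≤ ∑ j, F i j * ((A i).indicator (1 : ℝ → ℝ) p.1 * (A' j).indicator (1 : ℝ → ℝ) p.2) :=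
        Finset.single_le_sum (f := fun j => F i j * ((A i).indicator (1 : ℝ → ℝ) p.1 *
          (A' j).indicator (1 : ℝ → ℝ) p.2)) (fun j _ => h0 i j) (Finset.mem_univ j)
    _ ≤ _ := Finset.single_le_sum (f := fun i => ∑ j, F i j * ((A i).indicator (1 : ℝ → ℝ) p.1 *
          (A' j).indicator (1 : ℝ → ℝ) p.2)) (fun i _ => Finset.sum_nonneg fun j _ => h0 i j)
          (Finset.mem_univ i)

lemma blockIdx_lt (m : ℕ) (hm : 0 < m) (x : ℝ) (h0 : 0 ≤ x) (h1 : x < 1) :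
    ((blockIdx m hm x : ℕ) : ℝ) ≤ x * m ∧ x * m < (blockIdx m hm x : ℕ) + 1 := by
  have hm' : (0 : ℝ) < m := by exact_mod_cast hm
  have hx : 0 ≤ x * m := by positivity
  have e : (⌊x * m⌋).toNat = ⌊x * m⌋₊ := by rw [Int.floor_toNat]
  have hlt : ⌊x * m⌋₊ < m := by
    rw [Nat.floor_lt hx]; nlinarith
  have e2 : (blockIdx m hm x : ℕ) = ⌊x * m⌋₊ := by
    simp only [blockIdx, e]; omega
  rw [e2]
  exact ⟨Nat.floor_le hx, Nat.lt_floor_add_one _⟩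

lemma blockIdx_one (m : ℕ) (hm : 0 < m) : (blockIdx m hm 1 : ℕ) = m - 1 := by
  simp [blockIdx]

lemma blockIdx_mem (m : ℕ) (hm : 0 < m) (x : ℝ) (h0 : 0 ≤ x) (h1 : x ≤ 1) :
    ((blockIdx m hm x : ℕ) : ℝ) ≤ x * m ∧ x * m ≤ (blockIdx m hm x : ℕ) + 1 := by
  rcases h1.lt_or_eq with h | rfl
  · exact ⟨(blockIdx_lt m hm x h0 h).1, (blockIdx_lt m hm x h0 h).2.le⟩
  · rw [blockIdx_one, Nat.cast_sub hm]; constructor <;> norm_num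

lemma mismatch (n k : ℕ) (hn : 0 < n) (hk : 0 < k) (hkn : k ≤ n) (x : ℝ) (h0 : 0 ≤ x)
    (h1 : x ≤ 1) :
    blockIdx k hk x = stdEquip n k hn hk (blockIdx n hn x) ∨
    ((blockIdx k hk x : ℕ) = (stdEquip n k hn hk (blockIdx n hn x) : ℕ) + 1 ∧
      x ≤ (blockIdx k hk x : ℕ) / (k : ℝ) + ((k : ℝ) - 1) / (k * n)) := by
  have hkR : (0 : ℝ) < k := by exact_mod_cast hk
  have hnR : (0 : ℝ) < n := by exact_mod_cast hn
  have hknR : (k : ℝ) ≤ n := by exact_mod_cast hkn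
  rcases h1.lt_or_eq with h | rfl
  · obtain ⟨a1, a2⟩ := blockIdx_lt k hk x h0 h
    obtain ⟨b1, b2⟩ := blockIdx_lt n hn x h0 h
    rw [Fin.ext_iff]
    have hq : (stdEquip n k hn hk (blockIdx n hn x) : ℕ) = (blockIdx n hn x : ℕ) * k / n := rfl
    rw [hq]
    generalize (blockIdx k hk x : ℕ) = s at *
    generalize (blockIdx n hn x : ℕ) = j at *
    have c1 : j * k / n * n ≤ j * k := Nat.div_mul_le_self _ _
    have c2 : j * k < (j * k / n + 1) * n := by
      rw [← Nat.div_lt_iff_lt_mul hn]; omega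
    generalize j * k / n = q at *
    have c1R : (q : ℝ) * n ≤ j * k := by exact_mod_cast c1
    have c2R : (j : ℝ) * k < (q + 1) * n := by exact_mod_cast c2
    have d1 : q < s + 1 := by
      have : (q : ℝ) < s + 1 := by
        have : (q : ℝ) * n < (s + 1) * n := by nlinarith
        exact lt_of_mul_lt_mul_right this hnR.le
      exact_mod_cast this
    have d2 : s < q + 2 := by
      have : (s : ℝ) < q + 2 := by
        have : (s : ℝ) * n < (q + 2) * n := by nlinarith
        exact lt_of_mul_lt_mul_right this hnR.le
      exact_mod_cast this
    by_cases hs : s = q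
    · exact Or.inl hs
    · have hs' : s = q + 1 := by omega
      refine Or.inr ⟨hs', ?_⟩
      have e1 : j * k + 1 ≤ s * n := by rw [hs']; omega
      have e1R : (j : ℝ) * k + 1 ≤ s * n := by exact_mod_cast e1
      have : (s : ℝ) / k + ((k : ℝ) - 1) / (k * n) = (s * n + (k - 1)) / (k * n) := by
        field_simp
      rw [this, le_div_iff₀ (by positivity)]
      nlinarith
  · left
    rw [Fin.ext_iff, blockIdx_one]
    change k - 1 = (blockIdx n hn 1 : ℕ) * k / n
    rw [blockIdx_one]
    symm
    obtain ⟨a, rfl⟩ : ∃ a, n = a + 1 := ⟨n - 1, by omega⟩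
    obtain ⟨b, rfl⟩ : ∃ b, k = b + 1 := ⟨k - 1, by omega⟩
    simp only [Nat.add_sub_cancel]
    exact Nat.div_eq_of_lt_le (by nlinarith) (by nlinarith)

lemma integral_stepFn_sq (k : ℕ) (hk : 0 < k) (B : Matrix (Fin k) (Fin k) ℝ) :
    ∫ p in Set.Icc (0 : ℝ) 1 ×ˢ Set.Icc (0 : ℝ) 1, (stepFn k B p.1 p.2) ^ 2
    ∂(volume : Measure (ℝ × ℝ)) = (∑ i, ∑ j, B i j ^ 2) * (1 / k * (1 / k)) := by
  have hkR : (0 : ℝ) < k := by exact_mod_cast hk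
  set R : Fin k → Set ℝ := fun j => Set.Ico ((j : ℕ) / (k : ℝ)) (((j : ℕ) + 1) / (k : ℝ)) with hR
  have hI : ∀ i, Integrable ((R i).indicator (1 : ℝ → ℝ)) volume := by
    intro i
    rw [integrable_indicator_iff measurableSet_Ico]
    exact integrableOn_const (by simp)
  have hV : ∀ i, ∫ x, (R i).indicator (1 : ℝ → ℝ) x = 1 / k := by
    intro i
    rw [integral_indicator_one measurableSet_Ico]
    have : ((i : ℕ) : ℝ) / k ≤ ((i : ℕ) + 1) / k := by gcongr; linarith
    rw [Measure.real, Real.volume_Ico, ENNReal.toReal_ofReal (by linarith)]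
    ring
  rw [← integral_indSum (fun i j => B i j ^ 2) R R hI hI _ _ hV hV]
  have hset : (Set.Icc (0 : ℝ) 1 ×ˢ Set.Icc (0 : ℝ) 1 : Set (ℝ × ℝ)) =ᵐ[volume]
      (Set.Ico (0 : ℝ) 1 ×ˢ Set.Ico (0 : ℝ) 1 : Set (ℝ × ℝ)) :=
    Measure.set_prod_ae_eq Ico_ae_eq_Icc.symm Ico_ae_eq_Icc.symm
  rw [setIntegral_congr_set hset, ← integral_indicator (measurableSet_Ico.prod measurableSet_Ico)]
  congr 1
  have key : ∀ x, x ∈ Set.Ico (0 : ℝ) 1 → ∀ i, x ∈ R i ↔ i = blockIdx k hk x := by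
    intro x hx i
    obtain ⟨a1, a2⟩ := blockIdx_lt k hk x hx.1 hx.2
    simp only [hR, Set.mem_Ico, div_le_iff₀ hkR, lt_div_iff₀ hkR]
    constructor
    · rintro ⟨b1, b2⟩
      have e1 : (i : ℕ) < (blockIdx k hk x : ℕ) + 1 := by
        exact_mod_cast b1.trans_lt a2
      have e2 : (blockIdx k hk x : ℕ) < (i : ℕ) + 1 := by
        exact_mod_cast a1.trans_lt b2
      exact Fin.ext (by omega)
    · rintro rfl; exact ⟨a1, a2⟩
  have key' : ∀ x, x ∉ Set.Ico (0 : ℝ) 1 → ∀ i, x ∉ R i := by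
    intro x hx i hi
    apply hx
    simp only [hR, Set.mem_Ico] at hi
    have : ((i : ℕ) + 1 : ℝ) ≤ k := by exact_mod_cast i.isLt
    exact ⟨le_trans (by positivity) hi.1, hi.2.trans_le (by rw [div_le_one hkR]; exact this)⟩
  funext p
  by_cases hx : p.1 ∈ Set.Ico (0 : ℝ) 1
  · by_cases hy : p.2 ∈ Set.Ico (0 : ℝ) 1
    · rw [Set.indicator_of_mem (Set.mk_mem_prod hx hy)]
      simp [indSum, Set.indicator_apply, key _ hx, key _ hy, stepFn, hk]
    · rw [Set.indicator_of_notMem (fun h => hy h.2)]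
      simp [indSum, Set.indicator_apply, key' _ hy]
  · rw [Set.indicator_of_notMem (fun h => hx h.1)]
    simp [indSum, Set.indicator_apply, key' _ hx]

/-- For a symmetric nonnegative `k×k` matrix `B` and the standard `k`-equipartition `π` of `[n]`
(`1 ≤ k ≤ n`), `‖W[B_π] − W[B]‖_{L²} ≤ √(10(k−1)/n)·‖W[B]‖_{L²}`. -/
theorem stepFn_equipartition_approx (n k : ℕ) (hk : 1 ≤ k) (hkn : k ≤ n)
    (B : Matrix (Fin k) (Fin k) ℝ) (hsym : B.IsSymm) (hpos : ∀ i j, 0 ≤ B i j) :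
    L2norm (fun x y =>
        stepFn n (liftPart (stdEquip n k (lt_of_lt_of_le hk hkn) hk) B) x y - stepFn k B x y)
      ≤ Real.sqrt (10 * ((k : ℝ) - 1) / (n : ℝ)) * L2norm (stepFn k B) := by
  have hn : 0 < n := lt_of_lt_of_le hk hkn
  have hkR : (0 : ℝ) < k := by exact_mod_cast hk
  have hk1 : (1 : ℝ) ≤ k := by exact_mod_cast hk
  have hnR : (0 : ℝ) < n := by exact_mod_cast hn
  have hknR : (k : ℝ) ≤ n := by exact_mod_cast hkn
  set δ : ℝ := ((k : ℝ) - 1) / (k * n) with hδ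
  have hδ0 : 0 ≤ δ := div_nonneg (by linarith) (by positivity)
  have hδk : δ ≤ 1 / k := by
    rw [hδ, div_le_div_iff₀ (by positivity) hkR]; nlinarith
  set F : Fin k → Fin k → ℝ := fun i j => B i j ^ 2 with hF
  have hF0 : ∀ i j, 0 ≤ F i j := fun i j => sq_nonneg _
  set P : Fin k → Set ℝ := fun i =>
    Set.Icc (((i : ℕ) + 1) / (k : ℝ)) (((i : ℕ) + 1) / (k : ℝ) + δ) with hP
  set T : Fin k → Set ℝ := fun i =>
    Set.Icc ((i : ℕ) / (k : ℝ)) (((i : ℕ) + 1) / (k : ℝ) + δ) with hT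
  set Q : Fin k → Set ℝ := fun i =>
    Set.Icc ((i : ℕ) / (k : ℝ)) ((i : ℕ) / (k : ℝ) + δ) with hQ
  set R : Fin k → Set ℝ := fun i =>
    Set.Icc ((i : ℕ) / (k : ℝ)) (((i : ℕ) + 1) / (k : ℝ)) with hR
  have IP : ∀ i, Integrable ((P i).indicator (1 : ℝ → ℝ)) volume := fun i => integrable_ind _ _
  have IT : ∀ i, Integrable ((T i).indicator (1 : ℝ → ℝ)) volume := fun i => integrable_ind _ _
  have IQ : ∀ i, Integrable ((Q i).indicator (1 : ℝ → ℝ)) volume := fun i => integrable_ind _ _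
  have IR : ∀ i, Integrable ((R i).indicator (1 : ℝ → ℝ)) volume := fun i => integrable_ind _ _
  have hstep : ∀ i : Fin k, ((i : ℕ) : ℝ) / k ≤ ((i : ℕ) + 1) / k := fun i => by
    gcongr; linarith
  have VP : ∀ i, ∫ x, (P i).indicator (1 : ℝ → ℝ) x = δ := fun i => by
    rw [integral_ind_Icc (by linarith)]; ring
  have VT : ∀ i, ∫ x, (T i).indicator (1 : ℝ → ℝ) x = 1 / k + δ := fun i => by
    rw [integral_ind_Icc (by linarith [hstep i])]; ring
  have VQ : ∀ i, ∫ x, (Q i).indicator (1 : ℝ → ℝ) x = δ := fun i => by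
    rw [integral_ind_Icc (by linarith)]; ring
  have VR : ∀ i, ∫ x, (R i).indicator (1 : ℝ → ℝ) x = 1 / k := fun i => by
    rw [integral_ind_Icc (hstep i)]; ring
  have J1 := integrable_indSum F P T IP IT
  have J2 := integrable_indSum F T P IT IP
  have J3 := integrable_indSum F Q R IQ IR
  have J4 := integrable_indSum F R Q IR IQ
  set t : ℝ → Fin k := fun x => stdEquip n k hn hk (blockIdx n hn x) with ht
  set s : ℝ → Fin k := fun x => blockIdx k hk x with hs
  have mR : ∀ x, x ∈ Set.Icc (0 : ℝ) 1 → x ∈ R (s x) := by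
    intro x hx
    obtain ⟨a1, a2⟩ := blockIdx_mem k hk x hx.1 hx.2
    exact ⟨by rw [div_le_iff₀ hkR]; exact a1, by rw [le_div_iff₀ hkR]; exact a2⟩
  have mPQ : ∀ x, x ∈ Set.Icc (0 : ℝ) 1 → s x ≠ t x → x ∈ P (t x) ∧ x ∈ Q (s x) := by
    intro x hx hne
    rcases mismatch n k hn hk hkn x hx.1 hx.2 with h | ⟨h, h'⟩
    · exact absurd h hne
    · have hq : x ∈ Q (s x) := ⟨(mR x hx).1, h'⟩
      refine ⟨?_, hq⟩
      have e : ((t x : ℕ) : ℝ) + 1 = (s x : ℕ) := by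
        have : (s x : ℕ) = (t x : ℕ) + 1 := h
        rw [this]; push_cast; ring
      simp only [hP, e]
      exact hq
  have mT : ∀ x, x ∈ Set.Icc (0 : ℝ) 1 → x ∈ T (t x) := by
    intro x hx
    by_cases h : s x = t x
    · rw [← h]
      exact ⟨(mR x hx).1, (mR x hx).2.trans (by linarith)⟩
    · have := (mPQ x hx h).1
      exact ⟨(hstep _).trans this.1, this.2⟩
  have hmain : ∫ p in Set.Icc (0 : ℝ) 1 ×ˢ Set.Icc (0 : ℝ) 1,
      (stepFn n (liftPart (stdEquip n k (lt_of_lt_of_le hk hkn) hk) B) p.1 p.2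
        - stepFn k B p.1 p.2) ^ 2 ∂(volume : Measure (ℝ × ℝ))
      ≤ ∫ p, (indSum F P T p + indSum F T P p + indSum F Q R p + indSum F R Q p) := by
    rw [← integral_indicator (measurableSet_Icc.prod measurableSet_Icc)]
    refine integral_mono_of_nonneg (Filter.Eventually.of_forall fun p => ?_)
      (((J1.add J2).add J3).add J4) (Filter.Eventually.of_forall fun p => ?_)
    · exact Set.indicator_nonneg (fun _ _ => sq_nonneg _) _
    · have n1 := indSum_nonneg F hF0 P T p
      have n2 := indSum_nonneg F hF0 T P p
      have n3 := indSum_nonneg F hF0 Q R p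
      have n4 := indSum_nonneg F hF0 R Q p
      beta_reduce
      by_cases hp : p ∈ Set.Icc (0 : ℝ) 1 ×ˢ Set.Icc (0 : ℝ) 1
      · rw [Set.indicator_of_mem hp]
        have hval : (stepFn n (liftPart (stdEquip n k (lt_of_lt_of_le hk hkn) hk) B) p.1 p.2
            - stepFn k B p.1 p.2) = B (t p.1) (t p.2) - B (s p.1) (s p.2) := by
          have hk' : 0 < k := hk
          simp [stepFn, liftPart, hn, hk', ht, hs]
        rw [hval]
        have hb : (B (t p.1) (t p.2) - B (s p.1) (s p.2)) ^ 2
            ≤ F (t p.1) (t p.2) + F (s p.1) (s p.2) := by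
          have := mul_nonneg (hpos (t p.1) (t p.2)) (hpos (s p.1) (s p.2))
          simp only [hF]; nlinarith
        by_cases hx : s p.1 = t p.1
        · by_cases hy : s p.2 = t p.2
          · rw [hx, hy]; simp only [sub_self]; linarith [sq_nonneg (0 : ℝ), zero_pow (M₀ := ℝ) two_ne_zero]
          · have m1 := le_indSum F hF0 T P p _ _ (mT _ hp.1) (mPQ _ hp.2 hy).1
            have m2 := le_indSum F hF0 R Q p _ _ (mR _ hp.1) (mPQ _ hp.2 hy).2
            linarith
        · have m1 := le_indSum F hF0 P T p _ _ (mPQ _ hp.1 hx).1 (mT _ hp.2)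
          have m2 := le_indSum F hF0 Q R p _ _ (mPQ _ hp.1 hx).2 (mR _ hp.2)
          linarith
      · rw [Set.indicator_of_notMem hp]; linarith
  have hG : ∫ p, (indSum F P T p + indSum F T P p + indSum F Q R p + indSum F R Q p)
      = (∑ i, ∑ j, F i j) * (2 * δ * (1 / k + δ) + 2 * δ * (1 / k)) := by
    rw [integral_add (f := fun p => indSum F P T p + indSum F T P p + indSum F Q R p)
        ((J1.add J2).add J3) J4,
      integral_add (f := fun p => indSum F P T p + indSum F T P p) (J1.add J2) J3,
      integral_add J1 J2,
      integral_indSum F P T IP IT _ _ VP VT, integral_indSum F T P IT IP _ _ VT VP,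
      integral_indSum F Q R IQ IR _ _ VQ VR, integral_indSum F R Q IR IQ _ _ VR VQ]
    ring
  have hS : 0 ≤ ∑ i, ∑ j, F i j :=
    Finset.sum_nonneg fun i _ => Finset.sum_nonneg fun j _ => hF0 i j
  unfold L2norm
  rw [← Real.sqrt_mul (div_nonneg (by linarith) hnR.le), integral_stepFn_sq k hk B]
  apply Real.sqrt_le_sqrt
  refine hmain.trans (hG.le.trans ?_)
  have e : 10 * ((k : ℝ) - 1) / n = 10 * (δ * k) := by rw [hδ]; field_simp
  rw [e]
  have e2 : 10 * (δ * k) * ((∑ i, ∑ j, B i j ^ 2) * (1 / k * (1 / k)))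
      = (∑ i, ∑ j, F i j) * (10 * δ * (1 / k)) := by
    simp only [hF]; field_simp
  rw [e2]
  refine mul_le_mul_of_nonneg_left ?_ hS
  have : δ * δ ≤ δ * (1 / k) := mul_le_mul_of_nonneg_left hδk hδ0
  have : 0 ≤ δ * (1 / k) := by positivity
  nlinarith

end
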